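/- Let Θ ⊆ I, let w₂, w₂' ∈ ^{Θ∪Θ^⊥}W and w, w̃ ∈ W_{Θ^⊥}. If w₂ ≥ w⁻¹w₂' and w₂' ≥ w̃⁻¹w₂ in the Bruhat order, then w = w̃ = 1 and w₂ = w₂'. -/

import Mathlib

open Classical

namespace Paper

variable {B : Type*} {M : CoxeterMatrix B} {W : Type*} [Group W]

/-- `Θ^⊥`: the indices whose simple reflections commute with all simple
reflections indexed by `Θ` (i.e. `m(i,j) = 2` for all `j ∈ Θ`). -/
def perp (M : CoxeterMatrix B) (Θ : Set B) : Set B := {i | i ∉ Θ ∧ ∀ j ∈ Θ, M i j = 2}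

variable (cs : CoxeterSystem M W)

/-- The standard parabolic subgroup `W_J` generated by the simple reflections indexed by `J`. -/
def parabolic (J : Set B) : Subgroup W := Subgroup.closure (cs.simple '' J)

/-- `W^J`: the minimal-length representatives of the cosets `W/W_J`,
`{w : ℓ(wu) = ℓ(w) + ℓ(u) for all u ∈ W_J}`. -/
def minRight (J : Set B) : Set W :=
  {w | ∀ u ∈ parabolic cs J, cs.length (w * u) = cs.length w + cs.length u}

/-- `^JW`: the minimal-length representatives of the cosets `W_J\W`,
`{w : ℓ(uw) = ℓ(u) + ℓ(w) for all u ∈ W_J}`. -/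
def minLeft (J : Set B) : Set W :=
  {w | ∀ u ∈ parabolic cs J, cs.length (u * w) = cs.length u + cs.length w}

/-- The Bruhat order on `W`: `x ≤ y` iff `y` is obtained from `x` by a chain of
right multiplications by reflections, each strictly increasing the length. -/
def bruhatLE : W → W → Prop :=
  Relation.ReflTransGen (fun x y => ∃ t, cs.IsReflection t ∧ y = x * t ∧ cs.length x < cs.length y)

/-- The equivalence relation `∼_Θ` on `W × W`:
`(x,y) ∼_Θ (x',y')` iff there are `u ∈ W_{Θ∪Θ^⊥}` and `v ∈ W_Θ` with `x' = xu`, `y' = u⁻¹vy`. -/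
def simRel (Θ : Set B) (p q : W × W) : Prop :=
  ∃ u ∈ parabolic cs (Θ ∪ perp M Θ), ∃ v ∈ parabolic cs Θ,
    q.1 = p.1 * u ∧ q.2 = u⁻¹ * v * p.2

/-- `w^J`: the minimal-length element of the coset `w W_J`. -/
noncomputable def projR (J : Set B) (w : W) : W :=
  if h : ∃ a, a ∈ minRight cs J ∧ a⁻¹ * w ∈ parabolic cs J then h.choose else w

/-- `^Jw`: the minimal-length element of the coset `W_J w`. -/
noncomputable def projL (J : Set B) (w : W) : W :=
  if h : ∃ a, a ∈ minLeft cs J ∧ w * a⁻¹ ∈ parabolic cs J then h.choose else w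

theorem parabolic_mono {J K : Set B} (h : J ⊆ K) : parabolic cs J ≤ parabolic cs K :=
  Subgroup.closure_mono (Set.image_mono h)

/-- Bruhat-comparable elements are equal or have strictly increasing lengths. -/
theorem bruhatLE.eq_or_length_lt {x y : W} (h : bruhatLE cs x y) :
    x = y ∨ cs.length x < cs.length y := by
  induction h with
  | refl => exact Or.inl rfl
  | tail _ hstep ih =>
    obtain ⟨_, _, _, hlt⟩ := hstep
    rcases ih with rfl | ih
    · exact Or.inr hlt
    · exact Or.inr (ih.trans hlt)

theorem length_inv_mul_of_mem_minLeft {J K : Set B} (hJK : J ⊆ K) {u w : W}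
    (hw : w ∈ minLeft cs K) (hu : u ∈ parabolic cs J) :
    cs.length (u⁻¹ * w) = cs.length u + cs.length w := by
  rw [hw _ (inv_mem (parabolic_mono cs hJK hu)), cs.length_inv]

/-- the key length-comparison lemma. If `w₂, w₂' ∈ ^{Θ∪Θ^⊥}W`,
`w, w̃ ∈ W_{Θ^⊥}`, `w₂ ≥ w⁻¹w₂'` and `w₂' ≥ w̃⁻¹w₂`, then `w = w̃ = 1` and `w₂ = w₂'`. -/
theorem statement9 [Finite B] (Θ : Set B) (w₂ w₂' w wt : W)
    (h₂ : w₂ ∈ minLeft cs (Θ ∪ perp M Θ)) (h₂' : w₂' ∈ minLeft cs (Θ ∪ perp M Θ))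
    (hw : w ∈ parabolic cs (perp M Θ)) (hwt : wt ∈ parabolic cs (perp M Θ))
    (hle : bruhatLE cs (w⁻¹ * w₂') w₂) (hle' : bruhatLE cs (wt⁻¹ * w₂) w₂') :
    w = 1 ∧ wt = 1 ∧ w₂ = w₂' := by
  have hlen := length_inv_mul_of_mem_minLeft cs Set.subset_union_right h₂' hw
  have hlen' := length_inv_mul_of_mem_minLeft cs Set.subset_union_right h₂ hwt
  have hcmp := bruhatLE.eq_or_length_lt cs hle
  have hcmp' := bruhatLE.eq_or_length_lt cs hle'
  have hl : cs.length (w⁻¹ * w₂') ≤ cs.length w₂ :=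
    hcmp.elim (fun h => (congrArg cs.length h).le) le_of_lt
  have hl' : cs.length (wt⁻¹ * w₂) ≤ cs.length w₂' :=
    hcmp'.elim (fun h => (congrArg cs.length h).le) le_of_lt
  have hw1 : w = 1 := cs.length_eq_zero_iff.mp (by omega)
  have hwt1 : wt = 1 := cs.length_eq_zero_iff.mp (by omega)
  refine ⟨hw1, hwt1, ?_⟩
  rcases hcmp with h | h
  · simpa [hw1] using h.symm
  · omega

end Paper
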